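/- Let A be a real M×N matrix, z ∈ ℝ^M, K ≥ 2 an integer, and for each layer k ∈ {1,…,K} let τ_k, σ_k ∈ ℝ, L_k a real P×N matrix, and f_k : ℝ^P → ℝ^P any map. Define sequences x_k ∈ ℝ^N and y_k ∈ ℝ^P by x₁ = Aᵀz, y₁ = 0, and for k = 1,…,K−1: x_{k+1} = x_k − τ_k·Aᵀ(Ax_k − z) − τ_k·L_kᵀy_k, y_{k+1} = f_k(y_k + σ_k·L_k(2x_{k+1} − x_k)). Then the DeepPDNet forward pass of Eq. (20) of the paper — namely u₁ = Aᵀz; first layer u₂ = η¹(D¹u₁ + b¹) with D¹ the (N+P)×N matrix stacking (I − τ₁·AᵀA) over σ₁·L₁(I − 2τ₁·AᵀA), b¹ = (τ₁·Aᵀz, 2τ₁σ₁·L₁Aᵀz), η¹ identity on the first N coordinates and f₁ on the last P; middle layers k = 2,…,K−1 as in Proposition 1 with parameters τ_k, σ_k, L_k, f_k; last layer u_{K+1} = D^K u_K + b^K with D^K = [I − τ_K·AᵀA, −τ_K·L_Kᵀ] and b^K = τ_K·Aᵀz — outputs u_{K+1} = x_{K+1} ∈ ℝ^N, i.e. the network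 output equals the primal iterate after K varying-parameter primal-dual steps started at x₁ = Aᵀz, y₁ = 0. -/

import Mathlib

open Matrix

/-- The layer weight matrix `D` of Proposition 1 / Eq. (20). -/
noncomputable def pdD {M N P : ℕ} (A : Matrix (Fin M) (Fin N) ℝ)
    (L : Matrix (Fin P) (Fin N) ℝ) (τ σ : ℝ) :
    Matrix (Fin N ⊕ Fin P) (Fin N ⊕ Fin P) ℝ :=
  Matrix.fromBlocks
    ((1 : Matrix (Fin N) (Fin N) ℝ) - τ • (Aᵀ * A)) (-(τ • Lᵀ))
    (σ • (L * ((1 : Matrix (Fin N) (Fin N) ℝ) - (2 * τ) • (Aᵀ * A))))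
    ((1 : Matrix (Fin P) (Fin P) ℝ) - (2 * τ * σ) • (L * Lᵀ))

/-- The layer bias vector `b` of Proposition 1 / Eq. (20). -/
noncomputable def pdb {M N P : ℕ} (A : Matrix (Fin M) (Fin N) ℝ)
    (L : Matrix (Fin P) (Fin N) ℝ) (z : Fin M → ℝ) (τ σ : ℝ) :
    Fin N ⊕ Fin P → ℝ :=
  Sum.elim (τ • (Aᵀ *ᵥ z)) ((2 * τ * σ) • (L *ᵥ (Aᵀ *ᵥ z)))

/-- The layer activation `η`: identity on the first `N` coordinates and `f`
on the last `P` coordinates. -/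
def pdEta {N P : ℕ} (f : (Fin P → ℝ) → (Fin P → ℝ)) :
    (Fin N ⊕ Fin P → ℝ) → (Fin N ⊕ Fin P → ℝ) :=
  fun u => Sum.elim (fun i => u (Sum.inl i)) (f (fun j => u (Sum.inr j)))

/-- The affine primal part of a layer is a primal step. -/
theorem primal_affine_eq {M N P : ℕ} (A : Matrix (Fin M) (Fin N) ℝ)
    (L : Matrix (Fin P) (Fin N) ℝ) (z : Fin M → ℝ) (τ : ℝ)
    (x : Fin N → ℝ) (y : Fin P → ℝ) :
    ((1 : Matrix (Fin N) (Fin N) ℝ) - τ • (Aᵀ * A)) *ᵥ x - τ • (Lᵀ *ᵥ y) + τ • (Aᵀ *ᵥ z) =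
      x - τ • (Aᵀ *ᵥ (A *ᵥ x - z)) - τ • (Lᵀ *ᵥ y) := by
  simp only [sub_mulVec, one_mulVec, smul_mulVec, mulVec_sub, mulVec_mulVec]
  module

/-- The affine dual part of a layer is the argument of the proximal map in a dual step. -/
theorem dual_affine_eq {M N P : ℕ} (A : Matrix (Fin M) (Fin N) ℝ)
    (L : Matrix (Fin P) (Fin N) ℝ) (z : Fin M → ℝ) (τ σ : ℝ)
    (x : Fin N → ℝ) (y : Fin P → ℝ) :
    (σ • (L * ((1 : Matrix (Fin N) (Fin N) ℝ) - (2 * τ) • (Aᵀ * A)))) *ᵥ x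
        + ((1 : Matrix (Fin P) (Fin P) ℝ) - (2 * τ * σ) • (L * Lᵀ)) *ᵥ y
        + (2 * τ * σ) • (L *ᵥ (Aᵀ *ᵥ z)) =
      y + σ • (L *ᵥ ((2 : ℝ) • (x - τ • (Aᵀ *ᵥ (A *ᵥ x - z)) - τ • (Lᵀ *ᵥ y)) - x)) := by
  simp only [sub_mulVec, one_mulVec, smul_mulVec, mulVec_sub, mulVec_smul, ← mulVec_mulVec]
  module

theorem pdEta_sumElim {N P : ℕ} (f : (Fin P → ℝ) → (Fin P → ℝ))
    (x : Fin N → ℝ) (y : Fin P → ℝ) :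
    pdEta f (Sum.elim x y) = Sum.elim x (f y) := rfl

/-- A layer applied to a primal-dual pair performs one primal-dual step. -/
theorem pdEta_pdD_mulVec_add_pdb {M N P : ℕ} (A : Matrix (Fin M) (Fin N) ℝ)
    (L : Matrix (Fin P) (Fin N) ℝ) (z : Fin M → ℝ) (τ σ : ℝ)
    (f : (Fin P → ℝ) → (Fin P → ℝ)) {x x' : Fin N → ℝ} {y : Fin P → ℝ}
    (hx' : x' = x - τ • (Aᵀ *ᵥ (A *ᵥ x - z)) - τ • (Lᵀ *ᵥ y)) :
    pdEta f (pdD A L τ σ *ᵥ Sum.elim x y + pdb A L z τ σ) =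
      Sum.elim x' (f (y + σ • (L *ᵥ ((2 : ℝ) • x' - x)))) := by
  subst hx'
  rw [← dual_affine_eq, ← primal_affine_eq, ← pdEta_sumElim, pdD, pdb, fromBlocks_mulVec,
    Sum.elim_comp_inl, Sum.elim_comp_inr, ← Sum.elim_add_add, neg_mulVec,
    smul_mulVec, ← sub_eq_add_neg]

/-- On a primal-dual pair with zero dual part, a layer only sees the first block column
of its weight matrix. -/
theorem pdD_mulVec_elim_zero {M N P : ℕ} (A : Matrix (Fin M) (Fin N) ℝ)
    (L : Matrix (Fin P) (Fin N) ℝ) (τ σ : ℝ) (x : Fin N → ℝ) :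
    pdD A L τ σ *ᵥ Sum.elim x 0 =
      Sum.elim (((1 : Matrix (Fin N) (Fin N) ℝ) - τ • (Aᵀ * A)) *ᵥ x)
        (σ • ((L * ((1 : Matrix (Fin N) (Fin N) ℝ) - (2 * τ) • (Aᵀ * A))) *ᵥ x)) := by
  rw [pdD, fromBlocks_mulVec, Sum.elim_comp_inl, Sum.elim_comp_inr, mulVec_zero, mulVec_zero,
    add_zero, add_zero, smul_mulVec]

/-- The DeepPDNet forward pass (Eq. (20)) with layer-dependent parameters
`τ_k, σ_k, L_k, f_k`, first layer applied to `u₁ = Aᵀz`, and last layer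
returning only the primal part, outputs the primal iterate after `K`
varying-parameter Condat–Vũ steps started at `x₁ = Aᵀz`, `y₁ = 0`.
(Indices are shifted by one: `x 0` is the paper's `x₁`, `v k` is the
paper's `u_{k+1}`, and `x K` is the paper's `x_{K+1}`.) -/
theorem deepPDNet_forward_eq_primal_iterate (M N P K : ℕ) (hK : 2 ≤ K)
    (A : Matrix (Fin M) (Fin N) ℝ) (z : Fin M → ℝ)
    (τ σ : ℕ → ℝ) (L : ℕ → Matrix (Fin P) (Fin N) ℝ)
    (f : ℕ → (Fin P → ℝ) → (Fin P → ℝ))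
    (x : ℕ → Fin N → ℝ) (y : ℕ → Fin P → ℝ) (v : ℕ → (Fin N ⊕ Fin P → ℝ))
    (hx0 : x 0 = Aᵀ *ᵥ z) (hy0 : y 0 = 0)
    (hx : ∀ k, x (k + 1) =
      x k - τ k • (Aᵀ *ᵥ (A *ᵥ x k - z)) - τ k • ((L k)ᵀ *ᵥ y k))
    (hy : ∀ k, y (k + 1) =
      f k (y k + σ k • (L k *ᵥ ((2 : ℝ) • x (k + 1) - x k))))
    -- first layer: `u₂ = η¹(D¹ u₁ + b¹)` with `u₁ = Aᵀz`
    (hv1 : v 1 = pdEta (f 0)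
      (Sum.elim
          ((((1 : Matrix (Fin N) (Fin N) ℝ) - τ 0 • (Aᵀ * A)) *ᵥ (Aᵀ *ᵥ z)))
          (σ 0 • ((L 0 * ((1 : Matrix (Fin N) (Fin N) ℝ)
              - (2 * τ 0) • (Aᵀ * A))) *ᵥ (Aᵀ *ᵥ z)))
        + pdb A (L 0) z (τ 0) (σ 0)))
    -- middle layers `k = 2, …, K − 1` of the paper
    (hv : ∀ k, 1 ≤ k → k ≤ K - 2 →
      v (k + 1) = pdEta (f k) (pdD A (L k) (τ k) (σ k) *ᵥ v k
        + pdb A (L k) z (τ k) (σ k))) :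
    -- last layer: `u_{K+1} = D^K u_K + b^K`, keeping only the primal part
    ((1 : Matrix (Fin N) (Fin N) ℝ) - τ (K - 1) • (Aᵀ * A)) *ᵥ
        (fun i => v (K - 1) (Sum.inl i))
      - τ (K - 1) • ((L (K - 1))ᵀ *ᵥ (fun j => v (K - 1) (Sum.inr j)))
      + τ (K - 1) • (Aᵀ *ᵥ z) = x K := by
  have iterate_eq : ∀ k, 1 ≤ k → k ≤ K - 1 → v k = Sum.elim (x k) (y k) := by
    intro k hk
    induction k, hk using Nat.le_induction with
    | base =>
      intro _
      rw [hv1, ← pdD_mulVec_elim_zero, ← hx0, ← hy0,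
        pdEta_pdD_mulVec_add_pdb A (L 0) z (τ 0) (σ 0) (f 0) (hx 0), ← hy 0]
    | succ k hk ih =>
      intro hkK
      rw [hv k hk (by omega), ih (by omega),
        pdEta_pdD_mulVec_add_pdb A (L k) z (τ k) (σ k) (f k) (hx k), ← hy k]
  obtain ⟨n, rfl⟩ : ∃ n, K = n + 1 := ⟨K - 1, by omega⟩
  rw [Nat.add_sub_cancel] at iterate_eq ⊢
  rw [iterate_eq n (by omega) le_rfl, hx n]
  exact primal_affine_eq A (L n) z (τ n) (x n) (y n)
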